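/- arXiv:2604.22670 — 5 statements merged into one kernel-verified Lean document; each statement's English description precedes it below -/
import Mathlib

section
/- Let Ψ : ℝ^d → ℝ be a convex, continuously differentiable function, let A be a d × d real matrix, and let α be a Borel probability measure on ℝ^d. Define T(x) = ∇Ψ(Aᵀx) and β = T#α (the pushforward of α by T). Then for every coupling π ∈ Π(α,β) such that (x,y) ↦ xᵀAy is π-integrable and x ↦ xᵀA·T(x) is α-integrable, one has ∫ xᵀAy dπ(x,y) ≤ ∫ xᵀA·T(x) dα(x). Equivalently, the deterministic coupling (Id, T)#α minimizes π ↦ ∫ (−xᵀAy) dπ over Π(α, T#α). -/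
open MeasureTheory Matrix

/-- The truncation of a real number to `[-n, n]`. -/
noncomputable def truncate (n : ℕ) (t : ℝ) : ℝ := max (-(n : ℝ)) (min t n)

theorem measurable_truncate (n : ℕ) : Measurable (truncate n) := by
  unfold truncate
  fun_prop

theorem norm_truncate_le (n : ℕ) (t : ℝ) : ‖truncate n t‖ ≤ n := by
  have hn : (0 : ℝ) ≤ n := n.cast_nonneg
  rw [Real.norm_eq_abs, abs_le]
  exact ⟨le_max_left _ _, max_le (by linarith) (min_le_right _ _)⟩

open Filter Topology in
theorem tendsto_truncate (t : ℝ) : Tendsto (fun n => truncate n t) atTop (𝓝 t) := by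
  apply tendsto_const_nhds.congr'
  filter_upwards [eventually_ge_atTop ⌈|t|⌉₊] with n hn
  obtain ⟨h₁, h₂⟩ := abs_le.mp (Nat.ceil_le.mp hn)
  simp only [truncate, min_eq_left h₂, max_eq_right h₁]

theorem min_add_zero_le_truncate_add_truncate (n : ℕ) (a b : ℝ) :
    min (a + b) 0 ≤ truncate n a + truncate n b := by
  have hn : (0 : ℝ) ≤ n := n.cast_nonneg
  simp only [truncate]
  grind

theorem truncate_add_truncate_le_max_add_zero (n : ℕ) (a b : ℝ) :
    truncate n a + truncate n b ≤ max (a + b) 0 := by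
  have hn : (0 : ℝ) ≤ n := n.cast_nonneg
  simp only [truncate]
  grind

theorem integrable_truncate_comp {Z : Type*} [MeasurableSpace Z] (μ : Measure Z)
    [IsProbabilityMeasure μ] {f : Z → ℝ} (hf : Measurable f) (n : ℕ) :
    Integrable (fun z => truncate n (f z)) μ :=
  .of_bound ((measurable_truncate n).comp hf).aestronglyMeasurable n
    (ae_of_all _ fun _ => norm_truncate_le n _)

open Filter Topology in
/-- Weak duality for optimal transport with a profit function `c`: a deterministic coupling
concentrated on the contact set of a pair of measurable potentials is optimal, even if the
potentials are not integrable. -/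
theorem integral_le_integral_of_measurable_potentials {X Y : Type*} [MeasurableSpace X]
    [MeasurableSpace Y] {α : Measure X} [IsProbabilityMeasure α] {T : X → Y} (hT : Measurable T)
    {π : Measure (X × Y)} [IsProbabilityMeasure π]
    (hπ₁ : π.map Prod.fst = α) (hπ₂ : π.map Prod.snd = α.map T)
    {φ : X → ℝ} {ψ : Y → ℝ} (hφ : Measurable φ) (hψ : Measurable ψ) {c : X × Y → ℝ}
    (hle : ∀ᵐ p ∂π, c p ≤ φ p.1 + ψ p.2) (heq : ∀ x, φ x + ψ (T x) = c (x, T x))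
    (hc : Integrable c π) (hcT : Integrable (fun x => c (x, T x)) α) :
    ∫ p, c p ∂π ≤ ∫ x, c (x, T x) ∂α := by
  have hmarg (n : ℕ) : ∫ p, truncate n (φ p.1) + truncate n (ψ p.2) ∂π
      = ∫ x, truncate n (φ x) + truncate n (ψ (T x)) ∂α := by
    rw [integral_add (f := fun p : X × Y => truncate n (φ p.1))
        (g := fun p : X × Y => truncate n (ψ p.2))
        (integrable_truncate_comp π (hφ.comp measurable_fst) n)
        (integrable_truncate_comp π (hψ.comp measurable_snd) n),
      integral_add (f := fun x => truncate n (φ x)) (g := fun x => truncate n (ψ (T x)))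
        (integrable_truncate_comp α hφ n) (integrable_truncate_comp α (hψ.comp hT) n)]
    congr 1
    · rw [← hπ₁]
      exact (integral_map measurable_fst.aemeasurable
        ((measurable_truncate n).comp hφ).aestronglyMeasurable).symm
    · have hψn {μ : Measure Y} : AEStronglyMeasurable (fun y => truncate n (ψ y)) μ :=
        ((measurable_truncate n).comp hψ).aestronglyMeasurable
      rw [← integral_map measurable_snd.aemeasurable hψn, hπ₂, integral_map hT.aemeasurable hψn]
  have hlim_α : Tendsto (fun n => ∫ x, truncate n (φ x) + truncate n (ψ (T x)) ∂α) atTop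
      (𝓝 (∫ x, c (x, T x) ∂α)) := by
    refine tendsto_integral_of_dominated_convergence (fun x => ‖c (x, T x)‖)
      (fun n => ((integrable_truncate_comp α hφ n).add
        (integrable_truncate_comp α (hψ.comp hT) n)).aestronglyMeasurable) hcT.norm
      (fun n => ae_of_all _ fun x => ?_) (ae_of_all _ fun x => ?_)
    · have h₁ := min_add_zero_le_truncate_add_truncate n (φ x) (ψ (T x))
      have h₂ := truncate_add_truncate_le_max_add_zero n (φ x) (ψ (T x))
      rw [heq] at h₁ h₂
      simp only [Real.norm_eq_abs]
      grind
    · rw [← heq]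
      exact (tendsto_truncate _).add (tendsto_truncate _)
  have hint_sum (n : ℕ) : Integrable (fun p => truncate n (φ p.1) + truncate n (ψ p.2)) π :=
    (integrable_truncate_comp π (hφ.comp measurable_fst) n).add
      (integrable_truncate_comp π (hψ.comp measurable_snd) n)
  have hlim_π : Tendsto
      (fun n => ∫ p, min (truncate n (φ p.1) + truncate n (ψ p.2)) |c p| ∂π) atTop
      (𝓝 (∫ p, min (φ p.1 + ψ p.2) |c p| ∂π)) := by
    refine tendsto_integral_of_dominated_convergence (fun p => ‖c p‖)
      (fun n => ((hint_sum n).inf hc.abs).aestronglyMeasurable) hc.norm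
      (fun n => ?_) (ae_of_all _ fun p => ?_)
    · filter_upwards [hle] with p hp
      have h₁ := min_add_zero_le_truncate_add_truncate n (φ p.1) (ψ p.2)
      simp only [Real.norm_eq_abs]
      grind
    · exact ((tendsto_truncate _).add (tendsto_truncate _)).min tendsto_const_nhds
  have hint_min : Integrable (fun p => min (φ p.1 + ψ p.2) |c p|) π := by
    refine hc.norm.mono' (((hφ.comp measurable_fst).add
      (hψ.comp measurable_snd)).aestronglyMeasurable.inf hc.abs.aestronglyMeasurable) ?_
    filter_upwards [hle] with p hp
    simp only [Real.norm_eq_abs]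
    grind
  calc ∫ p, c p ∂π ≤ ∫ p, min (φ p.1 + ψ p.2) |c p| ∂π := by
        refine integral_mono_ae hc hint_min ?_
        filter_upwards [hle] with p hp using le_min hp (le_abs_self _)
    _ ≤ ∫ x, c (x, T x) ∂α := by
        refine le_of_tendsto_of_tendsto' hlim_π hlim_α fun n => ?_
        rw [← hmarg n]
        exact integral_mono ((hint_sum n).inf hc.abs) (hint_sum n) fun p => min_le_left _ _

theorem ConvexOn.add_fderiv_le {E : Type*} [NormedAddCommGroup E] [NormedSpace ℝ E]
    {f : E → ℝ} (hf : ConvexOn ℝ Set.univ f) {x : E} (hfx : DifferentiableAt ℝ f x) (y : E) :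
    f x + fderiv ℝ f x (y - x) ≤ f y := by
  have hline : ConvexOn ℝ Set.univ (f ∘ AffineMap.lineMap (k := ℝ) x y) :=
    hf.comp_affineMap (AffineMap.lineMap x y)
  have hderiv : HasDerivAt (f ∘ AffineMap.lineMap (k := ℝ) x y) (fderiv ℝ f x (y - x)) 0 := by
    refine HasFDerivAt.comp_hasDerivAt (x := (0 : ℝ)) ?_ AffineMap.hasDerivAt_lineMap
    simpa using hfx.hasFDerivAt
  have h := hline.le_slope_of_hasDerivAt (Set.mem_univ 0) (Set.mem_univ 1) zero_lt_one hderiv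
  simp only [slope_def_field, Function.comp_apply, AffineMap.lineMap_apply_zero,
    AffineMap.lineMap_apply_one, sub_zero, div_one] at h
  linarith

/-- The Legendre conjugate of `f`, as a supremum over a countable dense set; it is only meaningful
where that supremum is finite. -/
noncomputable def legendreConjugate {d : ℕ} (f : (Fin d → ℝ) → ℝ) (y : Fin d → ℝ) : ℝ :=
  ⨆ n, TopologicalSpace.denseSeq (Fin d → ℝ) n ⬝ᵥ y - f (TopologicalSpace.denseSeq _ n)

/-- The effective domain of `legendreConjugate f`. -/
def legendreDomain {d : ℕ} (f : (Fin d → ℝ) → ℝ) : Set (Fin d → ℝ) :=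
  {y | BddAbove (Set.range fun n =>
    TopologicalSpace.denseSeq (Fin d → ℝ) n ⬝ᵥ y - f (TopologicalSpace.denseSeq _ n))}

theorem measurable_dotProduct_sub {d : ℕ} (u : Fin d → ℝ) (a : ℝ) :
    Measurable fun y : Fin d → ℝ => u ⬝ᵥ y - a := by
  unfold dotProduct
  fun_prop

theorem measurable_legendreConjugate {d : ℕ} (f : (Fin d → ℝ) → ℝ) :
    Measurable (legendreConjugate f) :=
  .iSup fun _ => measurable_dotProduct_sub _ _

theorem measurableSet_legendreDomain {d : ℕ} (f : (Fin d → ℝ) → ℝ) :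
    MeasurableSet (legendreDomain f) :=
  measurableSet_bddAbove_range fun _ => measurable_dotProduct_sub _ _

theorem dotProduct_le_add_legendreConjugate {d : ℕ} {f : (Fin d → ℝ) → ℝ} (hf : Continuous f)
    {y : Fin d → ℝ} (hy : y ∈ legendreDomain f) (u : Fin d → ℝ) :
    u ⬝ᵥ y ≤ f u + legendreConjugate f y := by
  refine (TopologicalSpace.denseRange_denseSeq (Fin d → ℝ)).induction_on u ?_ fun n => ?_
  · exact isClosed_le (by unfold dotProduct; fun_prop) (by fun_prop)
  · have h := le_ciSup hy n
    change _ ≤ legendreConjugate f y at h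
    linarith

theorem fderiv_apply_eq_dotProduct {d : ℕ} (f : (Fin d → ℝ) → ℝ) (u w : Fin d → ℝ) :
    fderiv ℝ f u w = w ⬝ᵥ fun i => fderiv ℝ f u (Pi.single i 1) := by
  conv_lhs => rw [pi_eq_sum_univ' w]
  simp [dotProduct, map_sum]

theorem dotProduct_gradient_sub_le {d : ℕ} {f : (Fin d → ℝ) → ℝ}
    (hf : ConvexOn ℝ Set.univ f) (hfd : Differentiable ℝ f) (u v : Fin d → ℝ) :
    (v ⬝ᵥ fun i => fderiv ℝ f u (Pi.single i 1)) - f v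
      ≤ (u ⬝ᵥ fun i => fderiv ℝ f u (Pi.single i 1)) - f u := by
  have h := hf.add_fderiv_le (hfd u) v
  rw [fderiv_apply_eq_dotProduct, sub_dotProduct] at h
  linarith

theorem gradient_mem_legendreDomain {d : ℕ} {f : (Fin d → ℝ) → ℝ}
    (hf : ConvexOn ℝ Set.univ f) (hfd : Differentiable ℝ f) (u : Fin d → ℝ) :
    (fun i => fderiv ℝ f u (Pi.single i 1)) ∈ legendreDomain f :=
  ⟨_, Set.forall_mem_range.mpr fun _ => dotProduct_gradient_sub_le hf hfd u _⟩

theorem add_legendreConjugate_gradient {d : ℕ} {f : (Fin d → ℝ) → ℝ}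
    (hf : ConvexOn ℝ Set.univ f) (hfd : Differentiable ℝ f) (u : Fin d → ℝ) :
    f u + legendreConjugate f (fun i => fderiv ℝ f u (Pi.single i 1))
      = u ⬝ᵥ fun i => fderiv ℝ f u (Pi.single i 1) := by
  refine le_antisymm ?_ (dotProduct_le_add_legendreConjugate hfd.continuous
    (gradient_mem_legendreDomain hf hfd u) u)
  have h : legendreConjugate f (fun i => fderiv ℝ f u (Pi.single i 1))
      ≤ (u ⬝ᵥ fun i => fderiv ℝ f u (Pi.single i 1)) - f u :=
    ciSup_le fun n => dotProduct_gradient_sub_le hf hfd u _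
  linarith

theorem dotProduct_mulVec_eq_transpose_mulVec {d : ℕ} (A : Matrix (Fin d) (Fin d) ℝ)
    (x y : Fin d → ℝ) : x ⬝ᵥ A.mulVec y = Aᵀ.mulVec x ⬝ᵥ y := by
  rw [dotProduct_mulVec, mulVec_transpose]

/-- The deterministic coupling induced by the map `T x = ∇Ψ(Aᵀ x)` (with `Ψ` convex
and `C¹`) maximizes `∫ xᵀ A y dπ` (equivalently, minimizes `∫ -xᵀAy dπ`) among all
couplings `π` of `α` and `β = T#α` for which the cost is integrable. The gradient
`∇Ψ(v)` is expressed componentwise by its partial derivatives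
`(∇Ψ(v))ᵢ = fderiv ℝ Ψ v (Pi.single i 1)`. -/
theorem stmt1 {d : ℕ}
    (Ψ : (Fin d → ℝ) → ℝ)
    (hΨconv : ConvexOn ℝ Set.univ Ψ)
    (hΨdiff : ContDiff ℝ 1 Ψ)
    (A : Matrix (Fin d) (Fin d) ℝ)
    (α : Measure (Fin d → ℝ)) [IsProbabilityMeasure α]
    (T : (Fin d → ℝ) → (Fin d → ℝ))
    (hT : ∀ x, T x = fun i => fderiv ℝ Ψ (Aᵀ.mulVec x) (Pi.single i 1))
    (π : Measure ((Fin d → ℝ) × (Fin d → ℝ))) [IsProbabilityMeasure π]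
    (hπ₁ : π.map Prod.fst = α)
    (hπ₂ : π.map Prod.snd = Measure.map T α)
    (hint₁ : Integrable (fun p : (Fin d → ℝ) × (Fin d → ℝ) => p.1 ⬝ᵥ A.mulVec p.2) π)
    (hint₂ : Integrable (fun x => x ⬝ᵥ A.mulVec (T x)) α) :
    ∫ p, p.1 ⬝ᵥ A.mulVec p.2 ∂π ≤ ∫ x, x ⬝ᵥ A.mulVec (T x) ∂α := by
  have hdiff : Differentiable ℝ Ψ := hΨdiff.differentiable one_ne_zero
  have hA : Continuous fun x : Fin d → ℝ => Aᵀ.mulVec x :=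
    continuous_const.matrix_mulVec continuous_id
  have hTmeas : Measurable T := by
    rw [funext hT]
    exact (continuous_pi fun i =>
      ((hΨdiff.continuous_fderiv one_ne_zero).comp hA).clm_apply continuous_const).measurable
  have hdom : ∀ᵐ p ∂π, p.2 ∈ legendreDomain Ψ := by
    have h : ∀ᵐ y ∂π.map Prod.snd, y ∈ legendreDomain Ψ := by
      rw [hπ₂]
      refine (ae_map_iff hTmeas.aemeasurable (measurableSet_legendreDomain Ψ)).mpr ?_
      refine ae_of_all _ fun x => ?_
      rw [hT]
      exact gradient_mem_legendreDomain hΨconv hdiff _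
    exact ae_of_ae_map measurable_snd.aemeasurable h
  refine integral_le_integral_of_measurable_potentials (φ := fun x => Ψ (Aᵀ.mulVec x))
    (c := fun p => p.1 ⬝ᵥ A.mulVec p.2) hTmeas hπ₁ hπ₂
    (hdiff.continuous.comp hA).measurable (measurable_legendreConjugate Ψ) ?_ (fun x => ?_)
    hint₁ hint₂
  · filter_upwards [hdom] with p hp
    rw [dotProduct_mulVec_eq_transpose_mulVec]
    exact dotProduct_le_add_legendreConjugate hdiff.continuous hp _
  · rw [dotProduct_mulVec_eq_transpose_mulVec, hT]
    exact add_legendreConjugate_gradient hΨconv hdiff _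
end

section
/- Let x₁, …, x_p ∈ ℝ^d and y₁, …, y_q ∈ ℝ^d be points, let a ∈ ℝ^p and b ∈ ℝ^q be probability vectors, and for a d × d matrix A set C(A)_{ij} = −x_iᵀ A y_j. Suppose P̂ ∈ U(a,b), A ∈ ℝ^{d×d}, f ∈ ℝ^p and g ∈ ℝ^q satisfy f_i + g_j = C(A)_{ij} for every (i,j) with P̂_{ij} > 0, and f_i + g_j < C(A)_{ij} for every (i,j) with P̂_{ij} = 0 (strict complementarity off the support). Then for every matrix H ∈ ℝ^{d×d} satisfying ⟨H, x_i y_jᵀ⟩ = 0 for all (i,j) with P̂_{ij} > 0, there exists ε > 0 such that for all t with |t| ≤ ε, P̂ minimizes P ↦ Σ_{i,j} C(A + tH)_{ij} P_{ij} over P ∈ U(a,b). -/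
open Matrix

/-- A separable function has the same total against any matrix with given marginals. -/
theorem sum_add_mul_eq_of_marginals {ι κ : Type*} [Fintype ι] [Fintype κ]
    (f a : ι → ℝ) (g b : κ → ℝ) (P : Matrix ι κ ℝ)
    (hrows : ∀ i, ∑ j, P i j = a i) (hcols : ∀ j, ∑ i, P i j = b j) :
    ∑ i, ∑ j, (f i + g j) * P i j = ∑ i, f i * a i + ∑ j, g j * b j := by
  simp only [add_mul, Finset.sum_add_distrib, ← hrows, ← hcols, Finset.mul_sum]
  rw [Finset.sum_comm (f := fun j i => g j * P i j)]

/-- Feasible dual potentials that are tight on the support of a transport plan certify its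
optimality. -/
theorem transport_cost_le_of_dual_certificate {ι κ : Type*} [Fintype ι] [Fintype κ]
    (C P Q : Matrix ι κ ℝ) (a f : ι → ℝ) (b g : κ → ℝ)
    (hle : ∀ i j, f i + g j ≤ C i j)
    (htight : ∀ i j, P i j ≠ 0 → f i + g j = C i j)
    (hProws : ∀ i, ∑ j, P i j = a i) (hPcols : ∀ j, ∑ i, P i j = b j)
    (hQ : ∀ i j, 0 ≤ Q i j)
    (hQrows : ∀ i, ∑ j, Q i j = a i) (hQcols : ∀ j, ∑ i, Q i j = b j) :
    ∑ i, ∑ j, C i j * P i j ≤ ∑ i, ∑ j, C i j * Q i j := by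
  calc ∑ i, ∑ j, C i j * P i j = ∑ i, ∑ j, (f i + g j) * P i j := by
        refine Finset.sum_congr rfl fun i _ => Finset.sum_congr rfl fun j _ => ?_
        by_cases h : P i j = 0
        · simp [h]
        · rw [htight i j h]
    _ = ∑ i, ∑ j, (f i + g j) * Q i j := by
        rw [sum_add_mul_eq_of_marginals f a g b P hProws hPcols,
          sum_add_mul_eq_of_marginals f a g b Q hQrows hQcols]
    _ ≤ ∑ i, ∑ j, C i j * Q i j :=
        Finset.sum_le_sum fun i _ => Finset.sum_le_sum fun j _ =>
          mul_le_mul_of_nonneg_right (hle i j) (hQ i j)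

/-- The Frobenius pairing with `u vᵀ` is the bilinear form evaluated at `u` and `v`. -/
theorem sum_mul_outer_eq_dotProduct_mulVec {m n : Type*} [Fintype m] [Fintype n]
    (H : Matrix m n ℝ) (u : m → ℝ) (v : n → ℝ) :
    ∑ k, ∑ l, H k l * (u k * v l) = u ⬝ᵥ H.mulVec v := by
  simp only [dotProduct, mulVec, Finset.mul_sum]
  exact Finset.sum_congr rfl fun k _ => Finset.sum_congr rfl fun l _ => by ring

/-- Local invariance of optimality under support-orthogonal perturbations of a
bilinear cost: if `P̂` is optimal for `C(A)_{ij} = -x_iᵀ A y_j` with strictly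
complementary dual potentials `(f, g)`, and `H` is Frobenius-orthogonal to all
`x_i y_jᵀ` with `(i,j)` in the support of `P̂`, then `P̂` remains optimal for
`C(A + tH)` for all sufficiently small `|t|`. -/
theorem stmt6 {d p q : ℕ}
    (x : Fin p → Fin d → ℝ) (y : Fin q → Fin d → ℝ)
    (a : Fin p → ℝ) (b : Fin q → ℝ)
    (ha : ∀ i, 0 ≤ a i) (hasum : ∑ i, a i = 1)
    (hb : ∀ j, 0 ≤ b j) (hbsum : ∑ j, b j = 1)
    (A : Matrix (Fin d) (Fin d) ℝ)
    (Phat : Matrix (Fin p) (Fin q) ℝ)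
    (hPhat_nonneg : ∀ i j, 0 ≤ Phat i j)
    (hPhat_rows : ∀ i, ∑ j, Phat i j = a i)
    (hPhat_cols : ∀ j, ∑ i, Phat i j = b j)
    (f : Fin p → ℝ) (g : Fin q → ℝ)
    (heq : ∀ i j, 0 < Phat i j → f i + g j = -(x i ⬝ᵥ A.mulVec (y j)))
    (hlt : ∀ i j, Phat i j = 0 → f i + g j < -(x i ⬝ᵥ A.mulVec (y j)))
    (H : Matrix (Fin d) (Fin d) ℝ)
    (hH : ∀ i j, 0 < Phat i j → ∑ k, ∑ l, H k l * (x i k * y j l) = 0) :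
    ∃ ε > (0 : ℝ), ∀ t : ℝ, |t| ≤ ε →
      ∀ P : Matrix (Fin p) (Fin q) ℝ,
        (∀ i j, 0 ≤ P i j) → (∀ i, ∑ j, P i j = a i) → (∀ j, ∑ i, P i j = b j) →
        ∑ i, ∑ j, (-(x i ⬝ᵥ (A + t • H).mulVec (y j))) * Phat i j ≤
          ∑ i, ∑ j, (-(x i ⬝ᵥ (A + t • H).mulVec (y j))) * P i j := by
  have hexp : ∀ (t : ℝ) i j, -(x i ⬝ᵥ (A + t • H).mulVec (y j)) =
      -(x i ⬝ᵥ A.mulVec (y j)) - t * (x i ⬝ᵥ H.mulVec (y j)) := fun t i j => by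
    rw [add_mulVec, smul_mulVec, dotProduct_add, dotProduct_smul, smul_eq_mul]
    ring
  have htight : ∀ (t : ℝ) i j, Phat i j ≠ 0 →
      f i + g j = -(x i ⬝ᵥ (A + t • H).mulVec (y j)) := fun t i j h => by
    have hpos := (hPhat_nonneg i j).lt_of_ne' h
    rw [hexp, ← sum_mul_outer_eq_dotProduct_mulVec H, hH i j hpos, heq i j hpos, mul_zero,
      sub_zero]
  have hfeas : ∀ᶠ t : ℝ in nhds 0, ∀ i j,
      f i + g j ≤ -(x i ⬝ᵥ (A + t • H).mulVec (y j)) := by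
    refine Filter.eventually_all.2 fun i => Filter.eventually_all.2 fun j => ?_
    by_cases h : Phat i j = 0
    · have hcont : Continuous fun t : ℝ =>
          -(x i ⬝ᵥ A.mulVec (y j)) - t * (x i ⬝ᵥ H.mulVec (y j)) := by fun_prop
      have hev := (hcont.tendsto 0).eventually_const_lt (u := f i + g j)
        (by simpa using hlt i j h)
      filter_upwards [hev] with t ht
      rw [hexp]
      exact ht.le
    · exact Filter.Eventually.of_forall fun t => (htight t i j h).le
  obtain ⟨ε, hε, hball⟩ := Metric.nhds_basis_closedBall.eventually_iff.1 hfeas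
  refine ⟨ε, hε, fun t ht P hP hrows hcols => ?_⟩
  have hle := hball (show t ∈ Metric.closedBall (0 : ℝ) ε by simpa using ht)
  exact transport_cost_le_of_dual_certificate
    (fun i j => -(x i ⬝ᵥ (A + t • H).mulVec (y j))) Phat P a f b g hle (htight t)
    hPhat_rows hPhat_cols hP hrows hcols
end

section
/- Fix b > 0 and ε > 0, and define g_ε(b) = 2b/(ε + √(ε² + 4b²)). Then g_ε(b) ∈ [0,1), and the function φ : (−1,1) → ℝ, φ(g) = −b·g − (ε/2)·log(1 − g²), attains its minimum over (−1,1) uniquely at g = g_ε(b), and the minimum value equals f_ε(b) = −2b²/(ε + √(ε² + 4b²)) + (ε/2)·(log(ε + √(ε² + 4b²)) − log(2ε)). -/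
/-- A positive critical point `x` of `g ↦ -b g - (ε/2) log(1 - g²)` is its strict global minimizer
over `(-1,1)`. -/
theorem neg_mul_sub_log_one_sub_sq_lt {b ε x g : ℝ} (hb : 0 < b) (hε : 0 < ε) (hx : 0 < x)
    (hcrit : b * (1 - x ^ 2) = ε * x) (hg : g ∈ Set.Ioo (-1 : ℝ) 1) (hgx : g ≠ x) :
    -b * x - ε / 2 * Real.log (1 - x ^ 2) < -b * g - ε / 2 * Real.log (1 - g ^ 2) := by
  have hX : 0 < 1 - x ^ 2 := pos_of_mul_pos_right (hcrit ▸ mul_pos hε hx) hb.le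
  have hG : 0 < 1 - g ^ 2 := by nlinarith [hg.1, hg.2]
  have hlog := Real.log_le_sub_one_of_pos (div_pos hG hX)
  rw [Real.log_div hG.ne' hX.ne'] at hlog
  have hpos : 0 < b * (x - g) ^ 2 / (2 * x) := by
    have : x - g ≠ 0 := sub_ne_zero.mpr hgx.symm
    positivity
  have hid : b * (x - g) - ε / 2 * ((1 - g ^ 2) / (1 - x ^ 2) - 1)
      = b * (x - g) ^ 2 / (2 * x) := by
    have hε_eq : ε = b * (1 - x ^ 2) / x := by rw [hcrit]; field_simp
    rw [hε_eq]
    field_simp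
    ring
  nlinarith [mul_le_mul_of_nonneg_left hlog (half_pos hε).le]

/-- The scalar entropic problem: for `b, ε > 0`, the quantity
`g_ε(b) = 2b/(ε + √(ε² + 4b²))` lies in `[0,1)` and is the unique minimizer over
`(-1,1)` of `φ(g) = -b g - (ε/2) log(1 - g²)`, with minimum value
`f_ε(b) = -2b²/(ε + √(ε² + 4b²)) + (ε/2)(log(ε + √(ε² + 4b²)) - log(2ε))`. -/
theorem stmt10 (b ε : ℝ) (hb : 0 < b) (hε : 0 < ε) :
    0 ≤ 2 * b / (ε + Real.sqrt (ε ^ 2 + 4 * b ^ 2)) ∧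
    2 * b / (ε + Real.sqrt (ε ^ 2 + 4 * b ^ 2)) < 1 ∧
    (∀ g ∈ Set.Ioo (-1 : ℝ) 1,
      (-b * (2 * b / (ε + Real.sqrt (ε ^ 2 + 4 * b ^ 2)))
          - ε / 2 * Real.log (1 - (2 * b / (ε + Real.sqrt (ε ^ 2 + 4 * b ^ 2))) ^ 2))
        ≤ -b * g - ε / 2 * Real.log (1 - g ^ 2)) ∧
    (∀ g ∈ Set.Ioo (-1 : ℝ) 1, g ≠ 2 * b / (ε + Real.sqrt (ε ^ 2 + 4 * b ^ 2)) →
      (-b * (2 * b / (ε + Real.sqrt (ε ^ 2 + 4 * b ^ 2)))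
          - ε / 2 * Real.log (1 - (2 * b / (ε + Real.sqrt (ε ^ 2 + 4 * b ^ 2))) ^ 2))
        < -b * g - ε / 2 * Real.log (1 - g ^ 2)) ∧
    (-b * (2 * b / (ε + Real.sqrt (ε ^ 2 + 4 * b ^ 2)))
        - ε / 2 * Real.log (1 - (2 * b / (ε + Real.sqrt (ε ^ 2 + 4 * b ^ 2))) ^ 2))
      = -(2 * b ^ 2) / (ε + Real.sqrt (ε ^ 2 + 4 * b ^ 2))
        + ε / 2 * (Real.log (ε + Real.sqrt (ε ^ 2 + 4 * b ^ 2)) - Real.log (2 * ε)) := by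
  set D := ε + Real.sqrt (ε ^ 2 + 4 * b ^ 2) with hD
  have hDpos : 0 < D := by positivity
  have hDsq : D ^ 2 - 4 * b ^ 2 = 2 * ε * D := by
    have := Real.sq_sqrt (show 0 ≤ ε ^ 2 + 4 * b ^ 2 by positivity)
    rw [hD]
    linarith
  have hx : 0 < 2 * b / D := by positivity
  have hsq : 1 - (2 * b / D) ^ 2 = 2 * ε / D := by
    field_simp
    linarith
  have hx1 : 2 * b / D < 1 := by
    have : 0 < 2 * ε / D := by positivity
    nlinarith
  have hcrit : b * (1 - (2 * b / D) ^ 2) = ε * (2 * b / D) := by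
    rw [hsq]
    ring
  have hlt := fun g (hg : g ∈ Set.Ioo (-1 : ℝ) 1) (hgx : g ≠ 2 * b / D) =>
    neg_mul_sub_log_one_sub_sq_lt hb hε hx hcrit hg hgx
  refine ⟨hx.le, hx1, fun g hg => ?_, hlt, ?_⟩
  · rcases eq_or_ne g (2 * b / D) with rfl | hgx
    · exact le_rfl
    · exact (hlt g hg hgx).le
  · rw [hsq, Real.log_div (by positivity) hDpos.ne']
    ring
end

section
/- Let X₁, …, X_n : Ω → ℝ^d be identically distributed random vectors and let σ > 0 satisfy E[exp(‖X₁‖²/(2dσ²))] ≤ 2. Then for every t > 0, ℙ( (1/n)·Σ_{i=1}^n exp(‖X_i‖²/(2d(σ+t)²)) > 2 ) ≤ 2^{1 − ((σ+t)/σ)²} ≤ exp(−t²·log 2/σ²). -/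
open MeasureTheory

/-- Markov's inequality for the `p`-th power of an empirical mean of nonnegative variables whose
`p`-th moments are bounded by `C`. -/
theorem measure_lt_mean_le_of_lintegral_rpow_le {Ω : Type*} [MeasurableSpace Ω]
    (μ : Measure Ω) {n : ℕ} (hn : 0 < n) {Y : Fin n → Ω → ℝ}
    (hY : ∀ i, Measurable (Y i)) (hY0 : ∀ i ω, 0 ≤ Y i ω) {p : ℝ} (hp : 1 ≤ p) {C : ENNReal}
    (hC : ∀ i, ∫⁻ ω, ENNReal.ofReal (Y i ω ^ p) ∂μ ≤ C) {a : ℝ} (ha : 0 < a) :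
    μ {ω | a < (1 / n : ℝ) * ∑ i, Y i ω} ≤ C / ENNReal.ofReal (a ^ p) := by
  have hn' : (0 : ℝ) < n := Nat.cast_pos.mpr hn
  have hap : 0 < a ^ p := Real.rpow_pos_of_pos ha p
  have hmean (ω : Ω) : ((1 / n : ℝ) * ∑ i, Y i ω) ^ p ≤ ∑ i, (1 / n : ℝ) * Y i ω ^ p := by
    rw [Finset.mul_sum]
    refine Real.rpow_arith_mean_le_arith_mean_rpow _ _ _ (fun _ _ => by positivity) ?_
      (fun i _ => hY0 i ω) hp
    simp [hn'.ne']
  have hint : ∫⁻ ω, ENNReal.ofReal (∑ i, (1 / n : ℝ) * Y i ω ^ p) ∂μ ≤ C := by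
    have hsplit (ω : Ω) : ENNReal.ofReal (∑ i, (1 / n : ℝ) * Y i ω ^ p)
        = ∑ i, ENNReal.ofReal (1 / n) * ENNReal.ofReal (Y i ω ^ p) := by
      rw [ENNReal.ofReal_sum_of_nonneg
        (fun i _ => mul_nonneg (by positivity) (Real.rpow_nonneg (hY0 i ω) p))]
      exact Finset.sum_congr rfl fun i _ => ENNReal.ofReal_mul (by positivity)
    simp_rw [hsplit]
    rw [lintegral_finsetSum _ fun i _ => by fun_prop]
    calc ∑ i, ∫⁻ ω, ENNReal.ofReal (1 / n) * ENNReal.ofReal (Y i ω ^ p) ∂μ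
        ≤ ∑ _i : Fin n, ENNReal.ofReal (1 / n) * C := by
          refine Finset.sum_le_sum fun i _ => ?_
          rw [lintegral_const_mul _ (by fun_prop)]
          gcongr
          exact hC i
      _ = C := by
          rw [Finset.sum_const, Finset.card_univ, Fintype.card_fin, nsmul_eq_mul, ← mul_assoc,
            ← ENNReal.ofReal_natCast, ← ENNReal.ofReal_mul hn'.le, mul_one_div_cancel hn'.ne',
            ENNReal.ofReal_one, one_mul]
  calc μ {ω | a < (1 / n : ℝ) * ∑ i, Y i ω}
      ≤ μ {ω | ENNReal.ofReal (a ^ p) ≤ ENNReal.ofReal (∑ i, (1 / n : ℝ) * Y i ω ^ p)} := by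
        refine measure_mono fun ω hω => ENNReal.ofReal_le_ofReal ?_
        exact (Real.rpow_le_rpow ha.le (le_of_lt hω) (by linarith)).trans (hmean ω)
    _ ≤ (∫⁻ ω, ENNReal.ofReal (∑ i, (1 / n : ℝ) * Y i ω ^ p) ∂μ) / ENNReal.ofReal (a ^ p) :=
        meas_ge_le_lintegral_div (by fun_prop) (by simpa using hap) ENNReal.ofReal_ne_top
    _ ≤ C / ENNReal.ofReal (a ^ p) := by gcongr

/-- Concentration of the empirical sub-Gaussian constant: if `X₁, …, X_n` are
identically distributed with `E[exp(‖X₁‖²/(2dσ²))] ≤ 2`, then for every `t > 0`, the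
probability that the empirical exponential moment at level `(σ+t)²` exceeds `2` is at
most `2^{1-((σ+t)/σ)²} ≤ exp(-t² log 2/σ²)`. -/
theorem stmt14 {Ω : Type*} [MeasurableSpace Ω]
    (μ : Measure Ω) [IsProbabilityMeasure μ]
    {d n : ℕ} (hd : 0 < d) (hn : 0 < n)
    (X : Fin n → Ω → EuclideanSpace ℝ (Fin d))
    (hmeas : ∀ i, Measurable (X i))
    (hid : ∀ i j, μ.map (X i) = μ.map (X j))
    (σ : ℝ) (hσ : 0 < σ)
    (hsub : ∀ i, ∫⁻ ω, ENNReal.ofReal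
        (Real.exp (‖X i ω‖ ^ 2 / (2 * d * σ ^ 2))) ∂μ ≤ 2)
    (t : ℝ) (ht : 0 < t) :
    μ {ω | 2 < (1 / n : ℝ) * ∑ i, Real.exp (‖X i ω‖ ^ 2 / (2 * d * (σ + t) ^ 2))}
        ≤ ENNReal.ofReal ((2 : ℝ) ^ (1 - ((σ + t) / σ) ^ 2)) ∧
      (2 : ℝ) ^ (1 - ((σ + t) / σ) ^ 2) ≤ Real.exp (-t ^ 2 * Real.log 2 / σ ^ 2) := by
  have hd' : (0 : ℝ) < d := Nat.cast_pos.mpr hd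
  have hst : 0 < σ + t := by positivity
  constructor
  · have hp : 1 ≤ ((σ + t) / σ) ^ 2 :=
      one_le_pow₀ ((one_le_div hσ).mpr (by linarith))
    have hpow (i : Fin n) (ω : Ω) :
        Real.exp (‖X i ω‖ ^ 2 / (2 * d * (σ + t) ^ 2)) ^ (((σ + t) / σ) ^ 2)
          = Real.exp (‖X i ω‖ ^ 2 / (2 * d * σ ^ 2)) := by
      rw [← Real.exp_mul]
      congr 1
      field_simp
    refine (measure_lt_mean_le_of_lintegral_rpow_le μ hn (C := 2)
      (Y := fun i ω => Real.exp (‖X i ω‖ ^ 2 / (2 * d * (σ + t) ^ 2)))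
      (fun i => by have := hmeas i; fun_prop) (fun _ _ => (Real.exp_pos _).le) hp
      (fun i => by simpa only [hpow] using hsub i) two_pos).trans_eq ?_
    rw [Real.rpow_sub two_pos, Real.rpow_one, ENNReal.ofReal_div_of_pos (by positivity),
      ENNReal.ofReal_ofNat]
  · rw [Real.rpow_def_of_pos two_pos, Real.exp_le_exp]
    have hexp : 1 - ((σ + t) / σ) ^ 2 ≤ -t ^ 2 / σ ^ 2 := by
      rw [div_pow, one_sub_div (by positivity)]
      gcongr
      nlinarith [mul_pos hσ ht]
    calc Real.log 2 * (1 - ((σ + t) / σ) ^ 2) ≤ Real.log 2 * (-t ^ 2 / σ ^ 2) :=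
          mul_le_mul_of_nonneg_left hexp (Real.log_nonneg one_le_two)
      _ = -t ^ 2 * Real.log 2 / σ ^ 2 := by ring
end

section
/- Fix ε > 0 and define f_ε(b) = −2b²/(ε + √(ε² + 4b²)) + (ε/2)·(log(ε + √(ε² + 4b²)) − log(2ε)) for b ≥ 0. Then the function b ↦ −b − f_ε(b) tends to −∞ as b → +∞. (Consequently, the entropic inverse optimal transport objective between Gaussian marginals, whose value at a matrix with singular values b_i equals −Σ_i (b_i + f_ε(b_i)), is unbounded from below.) -/
/-- The entropic inverse OT objective between Gaussian marginals is unbounded below: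
with `f_ε(b) = -2b²/(ε + √(ε² + 4b²)) + (ε/2)(log(ε + √(ε² + 4b²)) - log(2ε))`, the
function `b ↦ -b - f_ε(b)` tends to `-∞` as `b → +∞`. -/
theorem stmt18 (ε : ℝ) (hε : 0 < ε) :
    Filter.Tendsto
      (fun b : ℝ =>
        -b - (-(2 * b ^ 2) / (ε + Real.sqrt (ε ^ 2 + 4 * b ^ 2))
          + ε / 2 * (Real.log (ε + Real.sqrt (ε ^ 2 + 4 * b ^ 2)) - Real.log (2 * ε))))
      Filter.atTop Filter.atBot := by
  have hbound : Filter.Tendsto (fun b : ℝ => -(ε / 2 * (Real.log b - Real.log (2 * ε))))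
      Filter.atTop Filter.atBot :=
    Filter.tendsto_neg_atTop_atBot.comp
      ((Filter.tendsto_atTop_add_const_right _ (-Real.log (2 * ε))
        Real.tendsto_log_atTop).const_mul_atTop (half_pos hε))
  refine Filter.tendsto_atBot_mono' _ ?_ hbound
  filter_upwards [Filter.eventually_gt_atTop 0] with b hb
  have hs : 2 * b ≤ Real.sqrt (ε ^ 2 + 4 * b ^ 2) :=
    Real.le_sqrt_of_sq_le (by nlinarith [sq_nonneg ε])
  have hquot : 2 * b ^ 2 / (ε + Real.sqrt (ε ^ 2 + 4 * b ^ 2)) ≤ b := by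
    rw [div_le_iff₀ (by linarith)]
    nlinarith
  have hlog : Real.log b ≤ Real.log (ε + Real.sqrt (ε ^ 2 + 4 * b ^ 2)) :=
    Real.log_le_log hb (by linarith)
  rw [neg_div]
  linarith [mul_le_mul_of_nonneg_left hlog (half_pos hε).le]
end
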